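/- (Factorization of the maximal squared shadow norm over product observable sets, Eq. (41) of the paper) Let E¹ and E² be informationally complete POVMs on ℂ^d, let ρ_1,…,ρ_G be Hermitian d×d matrices and X_1,…,X_H be Hermitian d×d matrices. Then max over 1 ≤ l ≤ G and 1 ≤ j ≤ H of ‖d · ρ_lᵀ ⊗ X_j‖²_{E¹⊗E²} equals d² · (max_{1 ≤ l ≤ G} ‖ρ_lᵀ‖²_{E¹}) · (max_{1 ≤ j ≤ H} ‖X_j‖²_{E²}). -/

import Mathlib

open Matrix
open scoped Kronecker ComplexOrder

def IsPOVM {n ι : Type*} [Fintype n] [DecidableEq n] [Fintype ι]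
    (E : ι → Matrix n n ℂ) : Prop :=
  (∀ k, (E k).PosSemidef) ∧ ∑ k, E k = 1

noncomputable def frameOp {n ι : Type*} [Fintype n] [DecidableEq n] [Fintype ι]
    (E : ι → Matrix n n ℂ) : Matrix n n ℂ →ₗ[ℂ] Matrix n n ℂ where
  toFun A := ∑ k, (A * E k).trace • E k
  map_add' A B := by
    simp [add_mul, Matrix.trace_add, add_smul, Finset.sum_add_distrib]
  map_smul' c A := by
    simp [Matrix.smul_mul, Matrix.trace_smul, smul_smul, Finset.smul_sum]

open Classical in
noncomputable def lambdaMax {n : Type*} [Fintype n] [DecidableEq n]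
    (A : Matrix n n ℂ) : ℝ :=
  if h : A.IsHermitian then ⨆ k, h.eigenvalues k else 0

noncomputable def shadowNormSq {n ι : Type*} [Fintype n] [DecidableEq n] [Fintype ι]
    (E sh : ι → Matrix n n ℂ) (X : Matrix n n ℂ) : ℝ :=
  lambdaMax (∑ k, (((sh k * X).trace.re) ^ 2 : ℝ) • E k)

theorem isHermitian_smul_one_sub {n : Type*} [DecidableEq n] {A : Matrix n n ℂ}
    (hA : A.IsHermitian) (μ : ℝ) :
    (μ • (1 : Matrix n n ℂ) - A).IsHermitian := by
  rw [IsHermitian, conjTranspose_sub, conjTranspose_smul, conjTranspose_one, hA.eq, star_trivial]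

theorem im_trace_mul_eq_zero {n : Type*} [Fintype n] {A B : Matrix n n ℂ}
    (hA : A.IsHermitian) (hB : B.IsHermitian) :
    (A * B).trace.im = 0 := by
  rw [← Complex.conj_eq_iff_im, starRingEnd_apply, ← trace_conjTranspose, conjTranspose_mul,
    hA.eq, hB.eq, trace_mul_comm]

theorem posSemidef_shadow_sum {n ι : Type*} [Fintype ι] {E : ι → Matrix n n ℂ}
    (hE : ∀ k, (E k).PosSemidef) (t : ι → ℝ) : (∑ k, (t k ^ 2) • E k).PosSemidef :=
  posSemidef_sum _ fun k _ => (hE k).smul (sq_nonneg _)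

section LambdaMax

variable {m n : Type*} [Fintype m] [DecidableEq m] [Fintype n] [DecidableEq n]

theorem lambdaMax_of_isEmpty [IsEmpty n] (A : Matrix n n ℂ) : lambdaMax A = 0 := by
  unfold lambdaMax
  split_ifs <;> simp

theorem Matrix.IsHermitian.exists_eigenvalues_eq {A : Matrix n n ℂ} (hA : A.IsHermitian) {μ : ℝ}
    {v : n → ℂ} (hv : v ≠ 0) (h : A *ᵥ v = μ • v) : ∃ k, hA.eigenvalues k = μ := by
  have hμ : μ ∈ spectrum ℝ A := by
    rw [spectrum.mem_iff]
    intro hu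
    obtain ⟨B, hB⟩ := hu.exists_left_inv
    apply hv
    have h0 : (algebraMap ℝ (Matrix n n ℂ) μ - A) *ᵥ v = 0 := by
      rw [sub_mulVec, h, Algebra.algebraMap_eq_smul_one, smul_mulVec, one_mulVec, sub_self]
    rw [← one_mulVec v, ← hB, ← mulVec_mulVec, h0, mulVec_zero]
  rwa [hA.spectrum_real_eq_range_eigenvalues] at hμ

theorem Matrix.IsHermitian.eigenvectorBasis_ne_zero {A : Matrix n n ℂ} (hA : A.IsHermitian)
    (k : n) : (hA.eigenvectorBasis k : n → ℂ) ≠ 0 := by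
  intro h
  apply hA.eigenvectorBasis.orthonormal.ne_zero k
  ext i
  exact congrFun h i

theorem Matrix.IsHermitian.lambdaMax_eq {A : Matrix n n ℂ} (hA : A.IsHermitian) :
    lambdaMax A = ⨆ k, hA.eigenvalues k := by
  rw [lambdaMax, dif_pos hA]

theorem lambdaMax_nonneg {A : Matrix n n ℂ} (hA : A.PosSemidef) : 0 ≤ lambdaMax A := by
  rw [hA.1.lambdaMax_eq]
  exact Real.iSup_nonneg hA.eigenvalues_nonneg

theorem Matrix.IsHermitian.exists_lambdaMax_eigenvector [Nonempty n] {A : Matrix n n ℂ}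
    (hA : A.IsHermitian) : ∃ v : n → ℂ, v ≠ 0 ∧ A *ᵥ v = lambdaMax A • v := by
  obtain ⟨k, hk⟩ := exists_eq_ciSup_of_finite (f := hA.eigenvalues)
  refine ⟨hA.eigenvectorBasis k, hA.eigenvectorBasis_ne_zero k, ?_⟩
  rw [hA.lambdaMax_eq, ← hk]
  exact hA.mulVec_eigenvectorBasis k

theorem Matrix.IsHermitian.posSemidef_lambdaMax_sub {A : Matrix n n ℂ} (hA : A.IsHermitian) :
    (lambdaMax A • (1 : Matrix n n ℂ) - A).PosSemidef := by
  have hB := isHermitian_smul_one_sub hA (lambdaMax A)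
  rw [hB.posSemidef_iff_eigenvalues_nonneg]
  intro i
  have h := hB.mulVec_eigenvectorBasis i
  rw [sub_mulVec, smul_mulVec, one_mulVec] at h
  obtain ⟨k, hk⟩ := hA.exists_eigenvalues_eq (hB.eigenvectorBasis_ne_zero i)
    (μ := lambdaMax A - hB.eigenvalues i) (by rw [sub_smul, ← h, sub_sub_cancel])
  have hle : hA.eigenvalues k ≤ lambdaMax A := by
    rw [hA.lambdaMax_eq]
    exact le_ciSup (Set.finite_range _).bddAbove k
  rw [Pi.zero_apply]
  linarith

/-- The largest eigenvalue is the eigenvalue that dominates the matrix in the Loewner order. -/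
theorem lambdaMax_eq_of_eigenvector {A : Matrix n n ℂ} (hA : A.IsHermitian) {μ : ℝ} {v : n → ℂ}
    (hv : v ≠ 0) (h : A *ᵥ v = μ • v) (hμ : (μ • (1 : Matrix n n ℂ) - A).PosSemidef) :
    lambdaMax A = μ := by
  obtain ⟨k, hk⟩ := hA.exists_eigenvalues_eq hv h
  have : Nonempty n := ⟨k⟩
  rw [hA.lambdaMax_eq]
  refine le_antisymm (ciSup_le fun i => ?_) (hk ▸ le_ciSup (Set.finite_range _).bddAbove k)
  obtain ⟨j, hj⟩ := hμ.1.exists_eigenvalues_eq (hA.eigenvectorBasis_ne_zero i)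
    (μ := μ - hA.eigenvalues i) (by
      rw [sub_mulVec, smul_mulVec, one_mulVec, sub_smul, hA.mulVec_eigenvectorBasis])
  have := hμ.eigenvalues_nonneg j
  linarith

theorem lambdaMax_smul {A : Matrix n n ℂ} (hA : A.IsHermitian) {c : ℝ} (hc : 0 ≤ c) :
    lambdaMax (c • A) = c * lambdaMax A := by
  cases isEmpty_or_nonempty n
  · simp [lambdaMax_of_isEmpty]
  obtain ⟨v, hv, h⟩ := hA.exists_lambdaMax_eigenvector
  refine lambdaMax_eq_of_eigenvector (hA.smul (IsSelfAdjoint.all c)) hv ?_ ?_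
  · rw [smul_mulVec, h, smul_smul]
  · rw [mul_smul, ← smul_sub]
    exact hA.posSemidef_lambdaMax_sub.smul hc

theorem lambdaMax_kronecker {A : Matrix m m ℂ} {B : Matrix n n ℂ}
    (hA : A.PosSemidef) (hB : B.PosSemidef) :
    lambdaMax (A ⊗ₖ B) = lambdaMax A * lambdaMax B := by
  cases isEmpty_or_nonempty m
  · simp [lambdaMax_of_isEmpty]
  cases isEmpty_or_nonempty n
  · simp [lambdaMax_of_isEmpty]
  obtain ⟨v, hv, hAv⟩ := hA.1.exists_lambdaMax_eigenvector
  obtain ⟨w, hw, hBw⟩ := hB.1.exists_lambdaMax_eigenvector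
  refine lambdaMax_eq_of_eigenvector (v := fun p => v p.1 * w p.2) (hA.kronecker hB).1 ?_ ?_ ?_
  · obtain ⟨i, hi⟩ := Function.ne_iff.mp hv
    obtain ⟨j, hj⟩ := Function.ne_iff.mp hw
    exact fun h => mul_ne_zero hi hj (congrFun h (i, j))
  · ext ⟨i, j⟩
    have hi := congrFun hAv i
    have hj := congrFun hBw j
    simp only [mulVec, dotProduct, Pi.smul_apply, Complex.real_smul] at hi hj
    simp only [mulVec, dotProduct, kronecker_apply, Fintype.sum_prod_type, Pi.smul_apply,
      Complex.real_smul, Complex.ofReal_mul]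
    calc ∑ x, ∑ y, A i x * B j y * (v x * w y)
        = (∑ x, A i x * v x) * ∑ y, B j y * w y := by
          rw [Finset.sum_mul_sum]
          exact Finset.sum_congr rfl fun x _ => Finset.sum_congr rfl fun y _ => by ring
      _ = _ := by rw [hi, hj]; ring
  · have hsplit : (lambdaMax A * lambdaMax B) • (1 : Matrix (m × n) (m × n) ℂ) - A ⊗ₖ B
        = lambdaMax A • ((1 : Matrix m m ℂ) ⊗ₖ (lambdaMax B • (1 : Matrix n n ℂ) - B))
          + (lambdaMax A • (1 : Matrix m m ℂ) - A) ⊗ₖ B := by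
      ext ⟨i, j⟩ ⟨i', j'⟩
      simp only [← one_kronecker_one, Matrix.sub_apply, Matrix.add_apply, Matrix.smul_apply,
        kronecker_apply, Complex.real_smul, Complex.ofReal_mul]
      ring
    rw [hsplit]
    exact ((PosSemidef.one.kronecker hB.1.posSemidef_lambdaMax_sub).smul
      (lambdaMax_nonneg hA)).add (hA.1.posSemidef_lambdaMax_sub.kronecker hB)

end LambdaMax

section FrameOp

variable {m n ι κ : Type*} [Fintype m] [DecidableEq m] [Fintype n] [DecidableEq n]
  [Fintype ι] [Fintype κ]

theorem frameOp_apply (E : ι → Matrix n n ℂ) (A : Matrix n n ℂ) :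
    frameOp E A = ∑ k, (A * E k).trace • E k := rfl

theorem trace_frameOp_mul (E : ι → Matrix n n ℂ) (A B : Matrix n n ℂ) :
    (frameOp E A * B).trace = (A * frameOp E B).trace := by
  simp only [frameOp_apply, Finset.sum_mul, Finset.mul_sum, trace_sum, Matrix.smul_mul,
    Matrix.mul_smul, trace_smul, smul_eq_mul]
  refine Finset.sum_congr rfl fun k _ => ?_
  rw [trace_mul_comm B, mul_comm]

theorem frameOp_conjTranspose {E : ι → Matrix n n ℂ} (hE : ∀ k, (E k).IsHermitian)
    (A : Matrix n n ℂ) : frameOp E Aᴴ = (frameOp E A)ᴴ := by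
  simp only [frameOp_apply, conjTranspose_sum, conjTranspose_smul]
  refine Finset.sum_congr rfl fun k _ => ?_
  rw [← trace_conjTranspose, conjTranspose_mul, (hE k).eq, trace_mul_comm]

theorem frameOp_kronecker (E : ι → Matrix m m ℂ) (F : κ → Matrix n n ℂ)
    (A : Matrix m m ℂ) (B : Matrix n n ℂ) :
    frameOp (fun k : ι × κ => E k.1 ⊗ₖ F k.2) (A ⊗ₖ B) = frameOp E A ⊗ₖ frameOp F B := by
  ext ⟨i, j⟩ ⟨i', j'⟩
  simp only [frameOp_apply, ← mul_kronecker_mul, trace_kronecker, Matrix.sum_apply, Matrix.smul_apply,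
    kronecker_apply, Fintype.sum_prod_type, smul_eq_mul, Finset.sum_mul_sum]
  exact Finset.sum_congr rfl fun x _ => Finset.sum_congr rfl fun y _ => by ring

theorem isHermitian_of_frameOp_eq {E : ι → Matrix n n ℂ} (hE : ∀ k, (E k).IsHermitian)
    (hIC : Function.Injective (frameOp E)) {S : Matrix n n ℂ} (hS : (frameOp E S).IsHermitian) :
    S.IsHermitian :=
  hIC (by rw [frameOp_conjTranspose hE, hS.eq])

/-- Classical shadows of a product POVM factorize when tested against product observables. -/
theorem trace_shadow_mul_kronecker {E : ι → Matrix m m ℂ} {F : κ → Matrix n n ℂ}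
    (hE : Function.Surjective (frameOp E)) (hF : Function.Surjective (frameOp F))
    {S : Matrix m m ℂ} {T : Matrix n n ℂ} {R : Matrix (m × n) (m × n) ℂ}
    (hR : frameOp (fun k : ι × κ => E k.1 ⊗ₖ F k.2) R = frameOp E S ⊗ₖ frameOp F T)
    (X : Matrix m m ℂ) (Y : Matrix n n ℂ) :
    (R * X ⊗ₖ Y).trace = (S * X).trace * (T * Y).trace := by
  obtain ⟨X, rfl⟩ := hE X
  obtain ⟨Y, rfl⟩ := hF Y
  rw [← frameOp_kronecker, ← trace_frameOp_mul, hR, ← mul_kronecker_mul, trace_kronecker,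
    trace_frameOp_mul, trace_frameOp_mul]

theorem shadowNormSq_nonneg {E : ι → Matrix n n ℂ} (hE : ∀ k, (E k).PosSemidef)
    (sh : ι → Matrix n n ℂ) (X : Matrix n n ℂ) : 0 ≤ shadowNormSq E sh X :=
  lambdaMax_nonneg (posSemidef_shadow_sum hE _)

theorem shadowNormSq_smul_kronecker {E : ι → Matrix m m ℂ} {F : κ → Matrix n n ℂ}
    (hE : ∀ k, (E k).PosSemidef) (hF : ∀ k, (F k).PosSemidef)
    (hICE : Function.Bijective (frameOp E)) (hICF : Function.Bijective (frameOp F))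
    {S : ι → Matrix m m ℂ} {T : κ → Matrix n n ℂ}
    (hS : ∀ a, frameOp E (S a) = E a) (hT : ∀ b, frameOp F (T b) = F b)
    {R : ι × κ → Matrix (m × n) (m × n) ℂ}
    (hR : ∀ k, frameOp (fun k' : ι × κ => E k'.1 ⊗ₖ F k'.2) (R k) = E k.1 ⊗ₖ F k.2)
    {X : Matrix m m ℂ} {Y : Matrix n n ℂ} (hX : X.IsHermitian) (c : ℝ) :
    shadowNormSq (fun k : ι × κ => E k.1 ⊗ₖ F k.2) R ((c : ℂ) • (X ⊗ₖ Y))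
      = c ^ 2 * (shadowNormSq E S X * shadowNormSq F T Y) := by
  have hP := posSemidef_shadow_sum hE fun a => (S a * X).trace.re
  have hQ := posSemidef_shadow_sum hF fun b => (T b * Y).trace.re
  simp only [shadowNormSq]
  rw [← lambdaMax_kronecker hP hQ, ← lambdaMax_smul (hP.kronecker hQ).1 (sq_nonneg c)]
  congr 1
  have htrace : ∀ k : ι × κ, (R k * ((c : ℂ) • (X ⊗ₖ Y))).trace.re
      = c * ((S k.1 * X).trace.re * (T k.2 * Y).trace.re) := by
    intro k
    have hSk : (S k.1).IsHermitian :=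
      isHermitian_of_frameOp_eq (fun a => (hE a).1) hICE.1 (by rw [hS]; exact (hE _).1)
    rw [Matrix.mul_smul, trace_smul, smul_eq_mul, Complex.re_ofReal_mul,
      trace_shadow_mul_kronecker (S := S k.1) (T := T k.2) hICE.2 hICF.2 (by rw [hR, hS, hT]),
      Complex.mul_re, im_trace_mul_eq_zero hSk hX, zero_mul, sub_zero]
  ext ⟨i, j⟩ ⟨i', j'⟩
  simp only [htrace, Matrix.sum_apply, Matrix.smul_apply, kronecker_apply, Fintype.sum_prod_type,
    Finset.sum_mul_sum, Finset.smul_sum, Complex.real_smul]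
  refine Finset.sum_congr rfl fun x _ => Finset.sum_congr rfl fun y _ => ?_
  push_cast
  ring

end FrameOp

theorem iSup_prod_mul_of_nonneg {α β : Type*} [Finite α] [Finite β] [Nonempty α] [Nonempty β]
    {f : α → ℝ} {g : β → ℝ} (hf : ∀ a, 0 ≤ f a) (hg : ∀ b, 0 ≤ g b) :
    ⨆ p : α × β, f p.1 * g p.2 = (⨆ a, f a) * ⨆ b, g b := by
  apply le_antisymm
  · exact ciSup_le fun p => mul_le_mul (le_ciSup (Set.finite_range f).bddAbove p.1)
      (le_ciSup (Set.finite_range g).bddAbove p.2) (hg _) (Real.iSup_nonneg hf)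
  · obtain ⟨a, ha⟩ := exists_eq_ciSup_of_finite (f := f)
    obtain ⟨b, hb⟩ := exists_eq_ciSup_of_finite (f := g)
    rw [← ha, ← hb]
    exact le_ciSup (f := fun p : α × β => f p.1 * g p.2) (Set.finite_range _).bddAbove (a, b)

/-- factorization of the maximal squared shadow norm over product
observable sets, Eq. (41). -/
theorem max_shadowNormSq_factorization
    {d N₁ N₂ G H : ℕ} (hG : 0 < G) (hH : 0 < H)
    (E₁ : Fin N₁ → Matrix (Fin d) (Fin d) ℂ)
    (E₂ : Fin N₂ → Matrix (Fin d) (Fin d) ℂ)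
    (hE₁ : IsPOVM E₁) (hE₂ : IsPOVM E₂)
    (hIC₁ : Function.Bijective (frameOp E₁))
    (hIC₂ : Function.Bijective (frameOp E₂))
    (sh₁ : Fin N₁ → Matrix (Fin d) (Fin d) ℂ)
    (sh₂ : Fin N₂ → Matrix (Fin d) (Fin d) ℂ)
    (hsh₁ : ∀ a, frameOp E₁ (sh₁ a) = E₁ a)
    (hsh₂ : ∀ b, frameOp E₂ (sh₂ b) = E₂ b)
    (shTot : Fin N₁ × Fin N₂ → Matrix (Fin d × Fin d) (Fin d × Fin d) ℂ)
    (hshTot : ∀ k, frameOp (fun k' : Fin N₁ × Fin N₂ => E₁ k'.1 ⊗ₖ E₂ k'.2) (shTot k)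
        = E₁ k.1 ⊗ₖ E₂ k.2)
    (ρ : Fin G → Matrix (Fin d) (Fin d) ℂ) (hρ : ∀ l, (ρ l).IsHermitian)
    (X : Fin H → Matrix (Fin d) (Fin d) ℂ) (hX : ∀ j, (X j).IsHermitian) :
    (⨆ p : Fin G × Fin H,
        shadowNormSq (fun k : Fin N₁ × Fin N₂ => E₁ k.1 ⊗ₖ E₂ k.2) shTot
          ((d : ℂ) • ((ρ p.1)ᵀ ⊗ₖ X p.2)))
      = (d : ℝ) ^ 2 * (⨆ l : Fin G, shadowNormSq E₁ sh₁ (ρ l)ᵀ)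
          * (⨆ j : Fin H, shadowNormSq E₂ sh₂ (X j)) := by
  have : Nonempty (Fin G) := ⟨⟨0, hG⟩⟩
  have : Nonempty (Fin H) := ⟨⟨0, hH⟩⟩
  have hnorm : ∀ p : Fin G × Fin H,
      shadowNormSq (fun k : Fin N₁ × Fin N₂ => E₁ k.1 ⊗ₖ E₂ k.2) shTot
          ((d : ℂ) • ((ρ p.1)ᵀ ⊗ₖ X p.2))
        = (d : ℝ) ^ 2 * (shadowNormSq E₁ sh₁ (ρ p.1)ᵀ * shadowNormSq E₂ sh₂ (X p.2)) := by
    intro p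
    rw [← Complex.ofReal_natCast]
    exact shadowNormSq_smul_kronecker hE₁.1 hE₂.1 hIC₁ hIC₂ hsh₁ hsh₂ hshTot
      (hρ p.1).transpose d
  simp only [hnorm]
  rw [← Real.mul_iSup_of_nonneg (sq_nonneg _), iSup_prod_mul_of_nonneg
    (f := fun l => shadowNormSq E₁ sh₁ (ρ l)ᵀ) (g := fun j => shadowNormSq E₂ sh₂ (X j))
    (fun l => shadowNormSq_nonneg hE₁.1 sh₁ (ρ l)ᵀ)
    (fun j => shadowNormSq_nonneg hE₂.1 sh₂ (X j)), mul_assoc]
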